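/- Let q ≥ 8 be a power of 2 and G = SL₂(F_q). Then for every irreducible complex character χ of G of degree q + 1 and every irreducible complex character ψ of G, the inner product ⟨χ², ψ⟩ is nonzero; that is, c(χ²) = Irr(G). -/

import Mathlib

open scoped BigOperators

/-- The standard inner product of complex-valued class functions on a finite group:
`⟨α, β⟩ = |G|⁻¹ ∑ g, α g * conj (β g)`. -/
noncomputable def charInner {G : Type} [Group G] [Finite G] (α β : G → ℂ) : ℂ :=
  letI : Fintype G := Fintype.ofFinite G
  (Fintype.card G : ℂ)⁻¹ * ∑ g : G, α g * (starRingEnd ℂ) (β g)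

/-- `χ : G → ℂ` is an irreducible character if it is the character of some
irreducible (simple) finite-dimensional complex representation of `G`. -/
def IsIrreducibleCharacter (G : Type) [Group G] (χ : G → ℂ) : Prop :=
  ∃ V : FDRep ℂ G, CategoryTheory.Simple V ∧ χ = V.character

open Matrix Module
open scoped MatrixGroups ComplexOrder

/-- The character of a complex representation of a finite group takes conjugate values on
inverse elements. -/
theorem Representation.character_inv_eq_conj {G V : Type*} [Group G] [Finite G]
    [AddCommGroup V] [Module ℂ V] [FiniteDimensional ℂ V] (ρ : Representation ℂ G V) (h : G) :
    ρ.character h⁻¹ = starRingEnd ℂ (ρ.character h) := by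
  classical
  have := Fintype.ofFinite G
  let b := finBasis ℂ V
  let M : G → Matrix (Fin (finrank ℂ V)) (Fin (finrank ℂ V)) ℂ := fun g =>
    LinearMap.toMatrix b b (ρ g)
  have hmul : ∀ g k, M (g * k) = M g * M k := fun g k => by
    simp only [M, map_mul, Module.End.mul_eq_comp, LinearMap.toMatrix_comp b b b]
  have hone : M 1 = 1 := by simp [M, Module.End.one_eq_id]
  let P := ∑ g, (M g)ᴴ * M g
  have hP : (M h)ᴴ * P * M h = P := by
    simp only [P, Finset.mul_sum, Finset.sum_mul]
    refine Fintype.sum_equiv (Equiv.mulRight h) _ _ fun g => ?_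
    simp [hmul, Matrix.conjTranspose_mul, Matrix.mul_assoc]
  have hpos : P.PosDef := by
    have : P = 1 + ∑ g ∈ Finset.univ.erase 1, (M g)ᴴ * M g := by
      have h1 : (M 1)ᴴ * M 1 = 1 := by simp [hone]
      rw [← h1, Finset.add_sum_erase _ (fun g => (M g)ᴴ * M g) (Finset.mem_univ (1 : G))]
    rw [this]
    exact Matrix.PosDef.one.add_posSemidef
      (Matrix.posSemidef_sum _ fun g _ => Matrix.posSemidef_conjTranspose_mul_self _)
  have hdet : IsUnit P.det := (Matrix.isUnit_iff_isUnit_det _).1 hpos.isUnit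
  have hconj : (M h)ᴴ = P * M h⁻¹ * P⁻¹ := by
    have : (M h)ᴴ * P = P * M h⁻¹ := by
      conv_rhs => rw [← hP]
      rw [Matrix.mul_assoc, ← hmul, mul_inv_cancel, hone, mul_one]
    rw [← this, Matrix.mul_assoc, Matrix.mul_nonsing_inv _ hdet, mul_one]
  have htr : ∀ g, ρ.character g = (M g).trace := fun g =>
    LinearMap.trace_eq_matrix_trace ℂ b (ρ g)
  rw [htr, htr, starRingEnd_apply, ← Matrix.trace_conjTranspose, hconj, Matrix.trace_mul_comm,
    ← Matrix.mul_assoc, Matrix.nonsing_inv_mul _ hdet, one_mul]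

/-- A nonzero invariant submodule of a simple representation is the whole space. -/
theorem FDRep.eq_top_of_simple {G : Type} [Group G] (V : FDRep ℂ G) [CategoryTheory.Simple V]
    (S : Submodule ℂ V) (hS : ∀ g, ∀ x ∈ S, V.ρ g x ∈ S) (hne : S ≠ ⊥) : S = ⊤ := by
  let τ : Subrepresentation V.ρ := ⟨S, fun g x hx => hS g x hx⟩
  let f : FDRep.of τ.toRepresentation ⟶ V :=
    ⟨FGModuleCat.ofHom S.subtype, fun g => by ext x; rfl⟩
  have hmono : CategoryTheory.Mono f :=
    CategoryTheory.ConcreteCategory.mono_of_injective f Subtype.val_injective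
  obtain ⟨x, hx, hx0⟩ := S.ne_bot_iff.1 hne
  have hf : f ≠ 0 := fun h => hx0 <| by
    have : f.hom.hom.hom ⟨x, hx⟩ = 0 := by rw [h]; rfl
    exact this
  have := CategoryTheory.isIso_of_mono_of_nonzero hf
  refine (Submodule.eq_top_iff').2 fun y => ?_
  have h1 : (CategoryTheory.CategoryStruct.comp (CategoryTheory.inv f) f).hom.hom.hom y = y := by
    rw [CategoryTheory.IsIso.inv_hom_id]; rfl
  rw [← h1]
  exact ((CategoryTheory.inv f).hom.hom.hom y : S).2

/-- A simple representation is nonzero. -/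
theorem FDRep.nontrivial_of_simple {G : Type} [Group G] (V : FDRep ℂ G)
    [CategoryTheory.Simple V] : Nontrivial V := by
  by_contra h
  rw [not_nontrivial_iff_subsingleton] at h
  refine CategoryTheory.id_nonzero V ?_
  ext x
  exact Subsingleton.elim _ _

namespace Matrix.SpecialLinearGroup

variable {F : Type*} [Field F]

/-- The upper unitriangular matrix with off-diagonal entry `a`. -/
def upper (a : F) : SL(2, F) := ⟨!![1, a; 0, 1], by simp⟩

/-- The diagonal matrix with entries `x` and `x⁻¹`. -/
def torus : Fˣ →* SL(2, F) where
  toFun x := ⟨!![(x : F), 0; 0, (x⁻¹ : F)], by simp⟩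
  map_one' := by ext i j; fin_cases i <;> fin_cases j <;> simp
  map_mul' x y := Subtype.ext <| show !![((x * y : Fˣ) : F), 0; 0, ((x * y : Fˣ)⁻¹ : F)] =
      !![(x : F), 0; 0, (x⁻¹ : F)] * !![(y : F), 0; 0, (y⁻¹ : F)] by simp [mul_comm]

/-- The standard representative of the nontrivial Weyl group element. -/
def weyl : SL(2, F) := ⟨!![0, -1; 1, 0], by simp⟩

@[simp]
theorem coe_upper (a : F) : (upper a : Matrix (Fin 2) (Fin 2) F) = !![1, a; 0, 1] := rfl

@[simp]
theorem coe_torus (x : Fˣ) :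
    (torus x : Matrix (Fin 2) (Fin 2) F) = !![(x : F), 0; 0, (x⁻¹ : F)] := rfl

@[simp]
theorem coe_weyl : ((weyl : SL(2, F)) : Matrix (Fin 2) (Fin 2) F) = !![0, -1; 1, 0] := rfl

theorem upper_zero : upper (0 : F) = 1 := by
  ext i j; fin_cases i <;> fin_cases j <;> simp

theorem upper_mul_upper (a b : F) : upper a * upper b = upper (a + b) := by
  ext i j; fin_cases i <;> fin_cases j <;> simp [add_comm]

theorem upper_inv (a : F) : (upper a)⁻¹ = upper (-a) := by
  rw [inv_eq_iff_mul_eq_one, upper_mul_upper, add_neg_cancel, upper_zero]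

theorem torus_mul_upper (x : Fˣ) (a : F) :
    torus x * upper a = upper ((x : F) ^ 2 * a) * torus x := by
  ext i j; fin_cases i <;> fin_cases j <;> simp
  field_simp

theorem torus_mul_weyl (x : Fˣ) : torus x * weyl = weyl * torus x⁻¹ := by
  ext i j; fin_cases i <;> fin_cases j <;> simp

theorem torus_eq_upper_conj (x : Fˣ) : torus x =
    upper (x : F) * (weyl * upper ((x : F)⁻¹) * weyl⁻¹) * upper (x : F) * upper (-1) *
      (weyl * upper (-1) * weyl⁻¹) * upper (-1) := by
  ext i j; fin_cases i <;> fin_cases j <;>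
    simp [adjugate_fin_two]

theorem exists_eq_upper_mul_torus {g : SL(2, F)} (hg : g 1 0 = 0) :
    ∃ a x, g = upper a * torus x := by
  have hdet := g.det_coe
  rw [det_fin_two, hg, mul_zero, sub_zero] at hdet
  refine ⟨g 0 1 * g 0 0, Units.mkOfMulEqOne _ _ hdet, ?_⟩
  ext i j
  fin_cases i <;> fin_cases j <;> simp [hg]
  · rw [mul_assoc, mul_inv_cancel₀ (left_ne_zero_of_mul_eq_one hdet), mul_one]
  · exact eq_inv_of_mul_eq_one_right hdet

theorem exists_eq_torus {g : SL(2, F)} (h₁₀ : g 1 0 = 0) (h₀₁ : g 0 1 = 0) :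
    ∃ x, g = torus x := by
  obtain ⟨a, x, rfl⟩ := exists_eq_upper_mul_torus h₁₀
  have ha : a = 0 := by simpa using h₀₁
  exact ⟨x, by rw [ha, upper_zero, one_mul]⟩

theorem weyl_conj_apply_one_zero (g : SL(2, F)) : (weyl⁻¹ * g * weyl : SL(2, F)) 1 0 = -g 0 1 := by
  simp [adjugate_fin_two, Matrix.mul_apply, Matrix.vecMul, dotProduct]

theorem exists_eq_upper_mul_weyl_mul {g : SL(2, F)} (hg : g 1 0 ≠ 0) :
    ∃ a b x, g = upper a * weyl * (upper b * torus x) := by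
  have hdet := g.det_coe
  rw [det_fin_two] at hdet
  refine ⟨g 0 0 / g 1 0, g 1 1 * g 1 0, Units.mk0 _ hg, ?_⟩
  ext i j
  fin_cases i <;> fin_cases j <;> simp [hg]
  field_simp
  linear_combination -hdet

end Matrix.SpecialLinearGroup

namespace Representation

open Matrix.SpecialLinearGroup

variable {F : Type*} [Field F] [Fintype F] {V : Type*} [AddCommGroup V] [Module ℂ V]
  (ρ : Representation ℂ SL(2, F) V)

theorem upper_apply_sum (b : F) (y : V) :
    ρ (upper b) (∑ a, ρ (upper a) y) = ∑ a, ρ (upper a) y := by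
  rw [map_sum]
  refine Fintype.sum_equiv (Equiv.addLeft b) _ _ fun a => ?_
  rw [← Module.End.mul_apply, ← map_mul, upper_mul_upper, Equiv.coe_addLeft]

theorem torus_apply_sum [DecidableEq F] (z : Fˣ) (y : V) :
    ρ (torus z) (∑ x, ρ (torus x) y) = ∑ x, ρ (torus x) y := by
  rw [map_sum]
  refine Fintype.sum_equiv (Equiv.mulLeft z) _ _ fun x => ?_
  rw [← Module.End.mul_apply, ← map_mul, ← map_mul, Equiv.coe_mulLeft]

/-- In characteristic two, the conjugates of a nontrivial torus element by the unipotent group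
fill out a coset of the unipotent group. -/
theorem sum_upper_conj_torus [CharP F 2] {x : Fˣ} (hx : x ≠ 1) (y : V) :
    ∑ a, ρ (upper a) (ρ (torus x) (ρ (upper a)⁻¹ y)) = ∑ a, ρ (upper a) (ρ (torus x) y) := by
  have h1 : 1 - (x : F) ^ 2 ≠ 0 := fun h => hx <| by
    have h2 : (1 - (x : F)) ^ 2 = 0 := by rw [sub_pow_char, one_pow, h]
    exact Units.ext (sub_eq_zero.1 (pow_eq_zero_iff two_ne_zero |>.1 h2)).symm
  refine Fintype.sum_equiv (Equiv.mulLeft₀ _ h1) _ _ fun a => ?_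
  simp only [← Module.End.mul_apply, ← map_mul]
  congr 2
  rw [upper_inv, torus_mul_upper, ← mul_assoc, upper_mul_upper]
  congr 2
  change a + (x : F) ^ 2 * -a = (1 - (x : F) ^ 2) * a
  ring

/-- In characteristic two, every nonzero representation of `SL₂(F)` has a nonzero vector fixed by
the diagonal torus. -/
theorem exists_torus_fixed [CharP F 2] [Nontrivial V] :
    ∃ w : V, w ≠ 0 ∧ ∀ x, ρ (torus x) w = w := by
  classical
  by_contra! hcon
  have hfix : ∀ w : V, (∀ x, ρ (torus x) w = w) → w = 0 := fun w hw => by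
    by_contra h
    obtain ⟨x, hx⟩ := hcon w h
    exact hx (hw x)
  have hsum : ∀ y, ∑ x, ρ (torus x) y = 0 := fun y => hfix _ fun z => ρ.torus_apply_sum z y
  have hupper_sum : ∀ y, ∑ a, ρ (upper a) y = (Fintype.card F : ℂ) • y := fun y => by
    have h0 : ∑ x, ∑ a, ρ (upper a) (ρ (torus x) (ρ (upper a)⁻¹ y)) = 0 := by
      rw [Finset.sum_comm]
      simp only [← map_sum, hsum, map_zero, Finset.sum_const_zero]
    have h1 : ∑ x, ∑ a, ρ (upper a) (ρ (torus x) y) = 0 := by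
      rw [Finset.sum_comm]
      simp only [← map_sum, hsum, map_zero, Finset.sum_const_zero]
    rw [← Finset.add_sum_erase _ _ (Finset.mem_univ 1)] at h0 h1
    rw [Finset.sum_congr rfl fun x hx => ρ.sum_upper_conj_torus (Finset.ne_of_mem_erase hx) y]
      at h0
    have h2 := h1.trans h0.symm
    rw [add_left_inj] at h2
    simpa [Nat.cast_smul_eq_nsmul] using h2
  have hupper : ∀ a y, ρ (upper a) y = y := fun a y => by
    have h := ρ.upper_apply_sum a y
    rw [hupper_sum, map_smul] at h
    exact smul_right_injective V (Nat.cast_ne_zero.2 Fintype.card_ne_zero) h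
  have hupper' : ∀ a, ρ (upper a) = 1 := fun a => LinearMap.ext (hupper a)
  obtain ⟨y, hy⟩ := exists_ne (0 : V)
  refine hy (hfix y fun x => ?_)
  rw [torus_eq_upper_conj]
  simp only [map_mul, hupper', mul_one, one_mul]
  rw [← map_mul, mul_inv_cancel, map_one, mul_one, Module.End.one_apply]

theorem character_upper [CharP F 2] {a : F} (ha : a ≠ 0) :
    ρ.character (upper a) = ρ.character (upper 1) := by
  obtain ⟨b, rfl⟩ := isSquare_of_charTwo' a
  have hb : b ≠ 0 := left_ne_zero_of_mul ha
  rw [← ρ.char_conj (upper 1) (torus (Units.mk0 b hb)), torus_mul_upper, mul_assoc,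
    mul_inv_cancel, mul_one, mul_one, Units.val_mk0, sq]

section FiniteDimensional

variable [FiniteDimensional ℂ V]

/-- The trace of an involution has the same parity as the dimension. -/
theorem exists_character_eq_of_mul_self {G : Type*} [Group G] (τ : Representation ℂ G V) {g : G}
    (hg : g * g = 1) : ∃ r : ℕ, τ.character g = 2 * r - finrank ℂ V := by
  let P : V →ₗ[ℂ] V := (2⁻¹ : ℂ) • (1 + τ g)
  have hsq : τ g * τ g = 1 := by rw [← map_mul, hg, map_one]
  have hP : IsIdempotentElem P := by
    change ((2⁻¹ : ℂ) • (1 + τ g)) * ((2⁻¹ : ℂ) • (1 + τ g)) = (2⁻¹ : ℂ) • (1 + τ g)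
    rw [smul_mul_smul_comm, mul_add, add_mul, add_mul, hsq]
    module
  refine ⟨finrank ℂ (LinearMap.range P), ?_⟩
  rw [← (LinearMap.IsIdempotentElem.isProj_range P hP).trace]
  simp only [P, map_smul, map_add, LinearMap.trace_one, character, smul_eq_mul]
  ring

/-- A representation of dimension `q + 1` of `SL₂(𝔽_q)`, with `q > 3` even, has a nonzero vector
fixed by the unipotent group. -/
theorem exists_upper_fixed [CharP F 2] (hcard : 3 < Fintype.card F)
    (hdim : finrank ℂ V = Fintype.card F + 1) :
    ∃ v : V, v ≠ 0 ∧ ∀ a, ρ (upper a) v = v := by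
  classical
  by_contra! hcon
  have hsum : ∑ a : F, ρ (upper a) = 0 := LinearMap.ext fun y => by
    by_contra h
    obtain ⟨a, ha⟩ := hcon _ h
    refine ha ?_
    simpa only [LinearMap.sum_apply] using ρ.upper_apply_sum a y
  have htr := congrArg (LinearMap.trace ℂ V) hsum
  rw [map_sum, map_zero, ← Finset.add_sum_erase _ _ (Finset.mem_univ (0 : F)),
    Finset.sum_congr rfl fun a ha =>
      show LinearMap.trace ℂ V (ρ (upper a)) = _ from
        ρ.character_upper (Finset.ne_of_mem_erase ha)] at htr
  have hinv : upper (1 : F) * upper 1 = 1 := by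
    rw [upper_mul_upper, CharTwo.add_self_eq_zero, upper_zero]
  obtain ⟨r, hr⟩ := ρ.exists_character_eq_of_mul_self hinv
  rw [hr, upper_zero, map_one, LinearMap.trace_one, hdim] at htr
  rw [Finset.sum_const, Finset.card_erase_of_mem (Finset.mem_univ _), Finset.card_univ] at htr
  obtain ⟨n, hn⟩ : ∃ n, Fintype.card F = n + 1 := ⟨Fintype.card F - 1, by omega⟩
  rw [hn] at htr hcard
  have hint : (n + 1 + 1 : ℤ) + n * (2 * r - (n + 1 + 1)) = 0 := by
    have : ((n + 1 + 1 : ℂ) + n * (2 * r - (n + 1 + 1))) = 0 := by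
      simpa using htr
    exact_mod_cast this
  have hdvd : (n : ℤ) ∣ 2 := ⟨-(2 * r - (n + 1 + 1)) - 1, by linear_combination hint⟩
  have := Int.le_of_dvd two_pos hdvd
  omega

/-- A representation of dimension `q + 1` of `SL₂(𝔽_q)`, with `q > 3` even, contains an eigenvector
of the Borel subgroup. -/
theorem exists_borel_eigenvector [CharP F 2] (hcard : 3 < Fintype.card F)
    (hdim : finrank ℂ V = Fintype.card F + 1) :
    ∃ v : V, v ≠ 0 ∧ (∀ a, ρ (upper a) v = v) ∧ ∀ x, ∃ c : ℂ, ρ (torus x) v = c • v := by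
  let S : Submodule ℂ V := ⨅ a, LinearMap.eqLocus (ρ (upper a)) LinearMap.id
  have hS : ∀ {y}, y ∈ S ↔ ∀ a, ρ (upper a) y = y := by simp [S]
  have hmap : ∀ x, ∀ y ∈ S, ρ (torus x) y ∈ S := fun x y hy => hS.2 fun a => by
    have : upper a * torus x = torus x * upper ((x : F)⁻¹ ^ 2 * a) := by
      rw [torus_mul_upper, ← mul_assoc, ← mul_pow, mul_inv_cancel₀ x.ne_zero, one_pow, one_mul]
    rw [← Module.End.mul_apply, ← map_mul, this, map_mul, Module.End.mul_apply, hS.1 hy]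
  obtain ⟨v₀, hv₀, hfix⟩ := ρ.exists_upper_fixed hcard hdim
  have : Nontrivial S := ⟨⟨⟨v₀, hS.2 hfix⟩, 0, fun h => hv₀ (congrArg Subtype.val h)⟩⟩
  obtain ⟨x₀, hx₀⟩ := IsCyclic.exists_generator (α := Fˣ)
  obtain ⟨c, hc⟩ := Module.End.exists_eigenvalue ((ρ (torus x₀)).restrict (hmap x₀))
  obtain ⟨⟨v, hvS⟩, hv⟩ := hc.exists_hasEigenvector
  have hv0 : v ≠ 0 := fun h => hv.2 (Subtype.ext h)
  have hvc : ρ (torus x₀) v = c • v := congrArg Subtype.val hv.apply_eq_smul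
  refine ⟨v, hv0, hS.1 hvS, fun x => ?_⟩
  obtain ⟨n, rfl⟩ := mem_powers_iff_mem_zpowers.2 (hx₀ x)
  refine ⟨c ^ n, ?_⟩
  induction n with
  | zero => simp
  | succ n ih =>
    simp only [map_pow] at ih ⊢
    rw [pow_succ', Module.End.mul_apply, ih, map_smul, hvc, smul_smul, pow_succ]

end FiniteDimensional

variable {ρ}

/-- A cyclic Borel eigenvector in a representation of dimension `q + 1` is detected by a functional
vanishing on its translates outside the Borel subgroup. -/
theorem exists_dual_borel_eigenvector (hdim : finrank ℂ V = Fintype.card F + 1) {v : V}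
    (hU : ∀ a, ρ (upper a) v = v) (hT : ∀ x, ∃ c : ℂ, ρ (torus x) v = c • v)
    (hspan : Submodule.span ℂ (Set.range fun g => ρ g v) = ⊤) :
    ∃ α : V →ₗ[ℂ] ℂ, α v = 1 ∧ ∀ g : SL(2, F), g 1 0 ≠ 0 → α (ρ g v) = 0 := by
  let e : Option F → V := fun i => i.elim v fun a => ρ (upper a * weyl) v
  have hborel : ∀ a x, ∃ c : ℂ, ρ (upper a * torus x) v = c • v := fun a x => by
    obtain ⟨c, hc⟩ := hT x
    exact ⟨c, by rw [map_mul, Module.End.mul_apply, hc, map_smul, hU]⟩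
  have hbig : ∀ g : SL(2, F), g 1 0 ≠ 0 → ∃ a, ∃ c : ℂ, ρ g v = c • e (some a) :=
    fun g hg => by
    obtain ⟨a, b, x, rfl⟩ := exists_eq_upper_mul_weyl_mul hg
    obtain ⟨c, hc⟩ := hborel b x
    exact ⟨a, c, by rw [map_mul, Module.End.mul_apply, hc, map_smul]; rfl⟩
  have htop : ⊤ ≤ Submodule.span ℂ (Set.range e) := by
    rw [← hspan, Submodule.span_le]
    rintro _ ⟨g, rfl⟩
    by_cases hg : g 1 0 = 0
    · obtain ⟨a, x, rfl⟩ := exists_eq_upper_mul_torus hg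
      obtain ⟨c, hc⟩ := hborel a x
      simp only [hc]
      exact Submodule.smul_mem _ c (Submodule.subset_span ⟨none, rfl⟩)
    · obtain ⟨a, c, hc⟩ := hbig g hg
      simp only [hc]
      exact Submodule.smul_mem _ c (Submodule.subset_span ⟨some a, rfl⟩)
  let b := basisOfTopLeSpanOfCardEqFinrank e htop (by rw [Fintype.card_option, hdim])
  have hb : ∀ i, b i = e i := fun i =>
    congrFun (coe_basisOfTopLeSpanOfCardEqFinrank e htop _) i
  refine ⟨b.coord none, ?_, fun g hg => ?_⟩
  · rw [show v = b none from (hb none).symm, b.coord_apply, b.repr_self, Finsupp.single_eq_same]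
  · obtain ⟨a, c, hc⟩ := hbig g hg
    rw [hc, ← hb, map_smul, b.coord_apply, b.repr_self,
      Finsupp.single_eq_of_ne (by simp), smul_zero]

/-- If `V` has dimension `q + 1` and is generated by a Borel eigenvector, then every representation
with a nonzero torus-fixed vector receives a nonzero equivariant bilinear map from `V × V`. -/
theorem exists_ne_zero_mem_invariants_linHom_linHom (hdim : finrank ℂ V = Fintype.card F + 1)
    {v : V} (hU : ∀ a, ρ (upper a) v = v) (hT : ∀ x, ∃ c : ℂ, ρ (torus x) v = c • v)
    (hspan : Submodule.span ℂ (Set.range fun g => ρ g v) = ⊤)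
    {W : Type*} [AddCommGroup W] [Module ℂ W] (σ : Representation ℂ SL(2, F) W)
    {w : W} (hw : w ≠ 0) (hfix : ∀ x, σ (torus x) w = w) :
    ∃ f ∈ (linHom ρ (linHom ρ σ)).invariants, f ≠ 0 := by
  classical
  obtain ⟨α, hαv, hα⟩ := exists_dual_borel_eigenvector hdim hU hT hspan
  let f₀ : V →ₗ[ℂ] V →ₗ[ℂ] W := α.smulRight ((α ∘ₗ ρ weyl⁻¹).smulRight w)
  let τ := linHom ρ (linHom ρ σ)
  have hterm : ∀ g : SL(2, F), τ g f₀ v (ρ weyl v) = if g ∈ torus.range then w else 0 :=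
    fun g => by
    have h1 : τ g f₀ v (ρ weyl v) =
        (α (ρ g⁻¹ v) * α (ρ (weyl⁻¹ * g⁻¹ * weyl) v)) • σ g w := by
      simp [τ, f₀, linHom_apply, smul_smul]
    rw [h1]
    split_ifs with hg
    · obtain ⟨x, rfl⟩ := hg
      obtain ⟨c, hc⟩ := hT x
      have hconj : weyl⁻¹ * (torus x)⁻¹ * weyl = torus x := by
        rw [← map_inv, mul_assoc, torus_mul_weyl, inv_inv, inv_mul_cancel_left]
      have hcinv : c * α (ρ (torus x)⁻¹ v) = 1 := by
        rw [← smul_eq_mul, ← map_smul, ← map_smul, ← hc, ← Module.End.mul_apply, ← map_mul,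
          inv_mul_cancel, map_one, Module.End.one_apply, hαv]
      rw [hconj, hc, map_smul, hαv, smul_eq_mul, mul_one, mul_comm, hcinv, one_smul, hfix]
    · by_cases h10 : g⁻¹ 1 0 = 0
      · have h01 : (weyl⁻¹ * g⁻¹ * weyl : SL(2, F)) 1 0 ≠ 0 := fun h => hg <| by
          rw [weyl_conj_apply_one_zero, neg_eq_zero] at h
          obtain ⟨x, hx⟩ := exists_eq_torus h10 h
          exact ⟨x⁻¹, by rw [map_inv, ← hx, inv_inv]⟩
        rw [hα _ h01, mul_zero, zero_smul]
      · rw [hα _ h10, zero_mul, zero_smul]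
  refine ⟨∑ g, τ g f₀, fun h => ?_, fun h => ?_⟩
  · rw [map_sum]
    refine Fintype.sum_equiv (Equiv.mulLeft h) _ _ fun g => ?_
    rw [← Module.End.mul_apply, ← map_mul, Equiv.coe_mulLeft]
  · have h2 : (∑ g, τ g f₀) v (ρ weyl v) = 0 := by rw [h]; rfl
    simp only [LinearMap.sum_apply, hterm] at h2
    rw [← Finset.sum_filter, Finset.sum_const, ← Nat.cast_smul_eq_nsmul ℂ, smul_eq_zero,
      Nat.cast_eq_zero, Finset.card_eq_zero, Finset.filter_eq_empty_iff] at h2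
    exact h2.elim (fun h3 => h3 (Finset.mem_univ 1) (one_mem _)) hw

end Representation

/-- For `q ≥ 8` a power of `2` and `G = SL₂(F_q)`, the square of any irreducible character
of degree `q + 1` contains every irreducible character of `G`. -/
theorem sl2_even_degree_q_plus_one_square_covers
    (q : ℕ) (hq8 : 8 ≤ q) (hq : ∃ n : ℕ, 1 ≤ n ∧ q = 2 ^ n)
    (F : Type) [Field F] [Fintype F] (hF : Fintype.card F = q)
    (χ ψ : Matrix.SpecialLinearGroup (Fin 2) F → ℂ)
    (hχ : IsIrreducibleCharacter _ χ) (hχdeg : χ 1 = (q : ℂ) + 1)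
    (hψ : IsIrreducibleCharacter _ ψ) :
    charInner (fun g => χ g ^ 2) ψ ≠ 0 := by
  obtain ⟨V, hV, rfl⟩ := hχ
  obtain ⟨W, hW, rfl⟩ := hψ
  subst hF
  have : CharP F 2 := by
    obtain ⟨n, -, hn⟩ := hq
    exact charP_of_card_eq_prime_pow hn
  have : Nontrivial W := FDRep.nontrivial_of_simple W
  have hdim : finrank ℂ V = Fintype.card F + 1 := by
    rw [FDRep.char_one] at hχdeg
    exact_mod_cast hχdeg
  obtain ⟨v, hv, hU, hT⟩ := Representation.exists_borel_eigenvector V.ρ (by omega) hdim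
  obtain ⟨w, hw, hfix⟩ := Representation.exists_torus_fixed W.ρ
  have hspan : Submodule.span ℂ (Set.range fun g => V.ρ g v) = ⊤ := by
    refine FDRep.eq_top_of_simple V _ (fun g x hx => ?_) fun h => hv ?_
    · refine (Submodule.span_le (p := (Submodule.span ℂ _).comap (V.ρ g))).2 ?_ hx
      rintro _ ⟨h, rfl⟩
      exact Submodule.subset_span ⟨g * h, by simp⟩
    · rw [Submodule.span_eq_bot] at h
      exact h v ⟨1, by simp⟩
  obtain ⟨f, hf, hf0⟩ := Representation.exists_ne_zero_mem_invariants_linHom_linHom hdim hU hT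
    hspan W.ρ hw hfix
  let G := Matrix.SpecialLinearGroup (Fin 2) F
  let _ : Fintype G := Fintype.ofFinite G
  let _ : Invertible (Nat.card G : ℂ) := invertibleOfNonzero (Nat.cast_ne_zero.2 Nat.card_pos.ne')
  have hinner : charInner (fun g => V.character g ^ 2) W.character = starRingEnd ℂ
      (finrank ℂ (Representation.linHom V.ρ (Representation.linHom V.ρ W.ρ)).invariants) := by
    rw [← Representation.card_inv_mul_sum_char_eq_finrank, charInner, Nat.card_eq_fintype_card,
      map_mul, map_inv₀, map_natCast, map_sum]
    congr 1
    refine Finset.sum_congr rfl fun g _ => ?_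
    rw [Representation.char_linHom, Representation.char_linHom,
      Representation.character_inv_eq_conj, map_mul, map_mul, Complex.conj_conj, ← mul_assoc, sq]
    rfl
  rw [hinner, Complex.conj_natCast, Nat.cast_ne_zero]
  exact fun h => hf0 ((Submodule.eq_bot_iff _).1 (Submodule.finrank_eq_zero.1 h) f hf)
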